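/- Let φ₁(x) = 1728·x·(x^2-11x-1)^5 / (x^4+228x^3+494x^2-228x+1)^3. There exists ε > 0 such that for all real x with |x| < ε, F(11/60, 31/60; 6/5; φ₁(x)) = (1 - 228x + 494x^2 + 228x^3 + x^4)^(11/20) / (1 + 11x - x^2). -/

import Mathlib

open Real

/-- The Gauss hypergeometric series `F(a,b;c;z) = ∑ ((a)_n (b)_n / ((c)_n n!)) z^n`,
where `(q)_n` is the rising (Pochhammer) factorial. -/
noncomputable def hypgeo (a b c z : ℝ) : ℝ :=
  ∑' n : ℕ, ((∏ i ∈ Finset.range n, (a + i)) * (∏ i ∈ Finset.range n, (b + i)) /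
    ((∏ i ∈ Finset.range n, (c + i)) * (Nat.factorial n))) * z ^ n

/-- The coefficients of the termwise derivative of the power series with coefficients `c`. -/
def derivCoeff (c : ℕ → ℝ) (n : ℕ) : ℝ := (n + 1) * c (n + 1)

/-- Polynomial growth of a real sequence. -/
def PolyGrowth (c : ℕ → ℝ) : Prop := ∃ (C : ℝ) (k : ℕ), ∀ n : ℕ, |c n| ≤ C * ((n : ℝ) + 1) ^ k

theorem PolyGrowth.deriv {c : ℕ → ℝ} (hc : PolyGrowth c) : PolyGrowth (derivCoeff c) := by
  obtain ⟨C, k, h⟩ := hc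
  have hC : 0 ≤ C := by
    have := (abs_nonneg _).trans (h 0)
    simpa using this
  refine ⟨C * 2 ^ k, k + 1, fun n => ?_⟩
  have hn : (0 : ℝ) ≤ n := Nat.cast_nonneg n
  have h1 := h (n + 1)
  push_cast at h1
  rw [derivCoeff, abs_mul, abs_of_nonneg (by positivity : (0 : ℝ) ≤ n + 1)]
  calc ((n : ℝ) + 1) * |c (n + 1)| ≤ (n + 1) * (C * (2 * (n + 1)) ^ k) := by
        gcongr
        refine h1.trans ?_
        gcongr
        linarith
    _ = C * 2 ^ k * (n + 1) ^ (k + 1) := by rw [mul_pow]; ring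

theorem PolyGrowth.summable {c : ℕ → ℝ} (hc : PolyGrowth c) {z : ℝ} (hz : |z| < 1) :
    Summable fun n => c n * z ^ n := by
  rcases eq_or_ne z 0 with rfl | hz0
  · refine summable_of_ne_finset_zero (s := {0}) fun n hn => ?_
    simp at hn
    simp [hn]
  obtain ⟨C, k, h⟩ := hc
  have h0 : Summable fun n : ℕ => ((n : ℝ) ^ k * |z| ^ n) :=
    summable_pow_mul_geometric_of_norm_lt_one k (by simpa using hz)
  have h1 := (((summable_nat_add_iff 1).2 h0).mul_left (C / |z|))
  refine Summable.of_norm_bounded h1 fun n => ?_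
  have hz' : 0 < |z| := abs_pos.2 hz0
  rw [Real.norm_eq_abs, abs_mul, abs_pow]
  calc |c n| * |z| ^ n ≤ C * ((n : ℝ) + 1) ^ k * |z| ^ n := by gcongr; exact h n
    _ = C / |z| * (((n + 1 : ℕ) : ℝ) ^ k * |z| ^ (n + 1)) := by
        push_cast; field_simp; ring

theorem PolyGrowth.hasDerivAt_tsum {c : ℕ → ℝ} (hc : PolyGrowth c) {z : ℝ} (hz : |z| < 1) :
    HasDerivAt (fun w => ∑' n, c n * w ^ n) (∑' n, derivCoeff c n * z ^ n) z := by
  obtain ⟨r, hzr, hr1⟩ := exists_between hz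
  have hr0 : 0 ≤ r := (abs_nonneg z).trans hzr.le
  have hr : |r| < 1 := by rwa [abs_of_nonneg hr0]
  have hd : PolyGrowth fun n => |derivCoeff c n| := by
    obtain ⟨C, k, h⟩ := hc.deriv
    exact ⟨C, k, fun n => by simpa using h n⟩
  have hu : Summable fun n : ℕ => |c n * (n * r ^ (n - 1))| := by
    rw [← summable_nat_add_iff 1]
    refine (hd.summable hr).congr fun n => ?_
    rw [derivCoeff, abs_mul, abs_mul, abs_mul, abs_of_nonneg (pow_nonneg hr0 _)]
    simp
    ring
  have key := hasDerivAt_tsum_of_isPreconnected (g := fun n w => c n * w ^ n)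
    (g' := fun n w => c n * (n * w ^ (n - 1))) (t := Metric.ball (0 : ℝ) r) (y₀ := 0) (y := z)
    hu Metric.isOpen_ball (convex_ball 0 r).isPreconnected
    (fun n y _ => (hasDerivAt_pow n y).const_mul (c n))
    (fun n y hy => by
      rw [Real.norm_eq_abs, abs_mul, abs_mul, abs_mul, abs_mul, abs_pow, abs_pow]
      have : |y| ≤ |r| := by
        rw [abs_of_nonneg hr0]
        simpa using (Metric.mem_ball.1 hy).le
      gcongr)
    (by simpa using (abs_nonneg z).trans_lt hzr) (hc.summable (by simp)) (by simpa using hzr)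
  convert! key using 1
  have hs : Summable fun n : ℕ => c n * (n * z ^ (n - 1)) := by
    rw [← summable_nat_add_iff 1]
    refine (hc.deriv.summable hz).congr fun n => ?_
    rw [derivCoeff]
    simp
    ring
  rw [hs.tsum_eq_zero_add]
  simp only [CharP.cast_eq_zero, zero_mul, mul_zero, zero_add]
  refine tsum_congr fun n => ?_
  rw [derivCoeff]
  push_cast
  ring

theorem HasSum.derivCoeff {c : ℕ → ℝ} {z S : ℝ} (h : HasSum (fun n => derivCoeff c n * z ^ n) S) :
    HasSum (fun n : ℕ => n * c n * z ^ n) (z * S) := by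
  rw [← hasSum_nat_add_iff' 1]
  convert! h.mul_left z using 1
  · ext n
    simp only [_root_.derivCoeff]
    push_cast
    ring
  · simp

/-- The coefficients of the Gauss hypergeometric series. -/
noncomputable def hypgeoCoeff (a b c : ℝ) (n : ℕ) : ℝ :=
  (∏ i ∈ Finset.range n, (a + i)) * (∏ i ∈ Finset.range n, (b + i)) /
    ((∏ i ∈ Finset.range n, (c + i)) * (Nat.factorial n))

theorem hypgeo_eq_tsum (a b c : ℝ) : hypgeo a b c = fun z => ∑' n, hypgeoCoeff a b c n * z ^ n :=
  rfl

theorem hypgeoCoeff_succ {a b c : ℝ} (hc : 0 < c) (n : ℕ) :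
    (n + 1) * (c + n) * hypgeoCoeff a b c (n + 1) = (a + n) * (b + n) * hypgeoCoeff a b c n := by
  have h1 : 0 < ∏ i ∈ Finset.range n, (c + i) := Finset.prod_pos fun i _ => by positivity
  have h2 : (0 : ℝ) < Nat.factorial n := by positivity
  have h3 : 0 < c + n := by positivity
  simp only [hypgeoCoeff, Finset.prod_range_succ, Nat.factorial_succ]
  push_cast
  field_simp

theorem polyGrowth_hypgeoCoeff {a b c : ℝ} (ha : 0 ≤ a) (hb : 0 ≤ b) (hac : a ≤ c) (hc : 0 < c)
    (hb1 : b ≤ 1) : PolyGrowth (hypgeoCoeff a b c) := by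
  suffices h : ∀ n, 0 ≤ hypgeoCoeff a b c n ∧ hypgeoCoeff a b c n ≤ 1 from
    ⟨1, 0, fun n => by simpa [abs_of_nonneg (h n).1] using (h n).2⟩
  intro n
  induction n with
  | zero => simp [hypgeoCoeff]
  | succ n ih =>
    have hn : (0 : ℝ) ≤ n := Nat.cast_nonneg n
    have hpos : 0 < (n + 1) * (c + n) := by positivity
    have hrec : hypgeoCoeff a b c (n + 1) =
        (a + n) * (b + n) * hypgeoCoeff a b c n / ((n + 1) * (c + n)) := by
      rw [eq_div_iff hpos.ne', ← hypgeoCoeff_succ hc]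
      ring
    rw [hrec]
    refine ⟨div_nonneg (mul_nonneg (by positivity) ih.1) hpos.le, (div_le_one hpos).2 ?_⟩
    calc (a + n) * (b + n) * hypgeoCoeff a b c n ≤ (a + n) * (b + n) * 1 := by
          gcongr
          exact ih.2
      _ ≤ (c + n) * (1 + n) * 1 := by gcongr
      _ = (n + 1) * (c + n) := by ring

/-- The hypergeometric differential equation. -/
theorem hypgeo_ode {a b c : ℝ} (hc : 0 < c) (hg : PolyGrowth (hypgeoCoeff a b c)) {z : ℝ}
    (hz : |z| < 1) :
    z * (1 - z) * (∑' n, derivCoeff (derivCoeff (hypgeoCoeff a b c)) n * z ^ n) +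
      (c - (a + b + 1) * z) * (∑' n, derivCoeff (hypgeoCoeff a b c) n * z ^ n) -
      a * b * hypgeo a b c z = 0 := by
  have h0 := (hg.summable hz).hasSum
  have h1 := (hg.deriv.summable hz).hasSum
  have h2 := (hg.deriv.deriv.summable hz).hasSum
  rw [hypgeo_eq_tsum]
  set u := hypgeoCoeff a b c
  set F0 := ∑' n, u n * z ^ n
  set F1 := ∑' n, derivCoeff u n * z ^ n
  set F2 := ∑' n, derivCoeff (derivCoeff u) n * z ^ n
  have h3 := h1.derivCoeff
  have h4 := h2.derivCoeff
  have h5 : HasSum (fun n : ℕ => n * ((n - 1) * u n) * z ^ n) (z * (z * F2)) := by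
    refine HasSum.derivCoeff ?_
    convert! h4 using 1
    ext n
    simp only [derivCoeff]
    push_cast
    ring
  have h6 := ((h4.sub h5).add (h1.mul_left c)).sub
    ((h3.mul_left (a + b + 1)).add (h0.mul_left (a * b)))
  have h7 := h6.unique (by
    convert! (hasSum_zero : HasSum (fun _ : ℕ => (0 : ℝ)) 0) using 1
    ext n
    have := hypgeoCoeff_succ (a := a) (b := b) hc n
    simp only [derivCoeff]
    linear_combination z ^ n * this)
  linear_combination h7

/-- A solution near `0` of `x * u' = -(6/5) * u` vanishes identically. -/
theorem eq_zero_of_mul_deriv_eq {u u' : ℝ → ℝ} {ε : ℝ}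
    (hu : ∀ x ∈ Metric.ball (0 : ℝ) ε, HasDerivAt u (u' x) x)
    (h : ∀ x ∈ Metric.ball (0 : ℝ) ε, x * u' x + 6 / 5 * u x = 0) :
    ∀ x ∈ Metric.ball (0 : ℝ) ε, u x = 0 := by
  intro x hx
  have h0 : (0 : ℝ) ∈ Metric.ball (0 : ℝ) ε :=
    Metric.mem_ball_self (Metric.pos_of_mem_ball hx)
  have hd : ∀ y ∈ Metric.ball (0 : ℝ) ε, HasDerivAt (fun y => y ^ 6 * u y ^ 5) 0 y := by
    intro y hy
    refine ((hasDerivAt_pow 6 y).mul ((hu y hy).pow 5)).congr_deriv ?_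
    push_cast
    simp only [Pi.pow_apply]
    linear_combination 5 * y ^ 5 * u y ^ 4 * h y hy
  have hconst := Metric.isOpen_ball.is_const_of_deriv_eq_zero (convex_ball (0 : ℝ) ε).isPreconnected
    (fun y hy => (hd y hy).differentiableAt.differentiableWithinAt) (fun y hy => (hd y hy).deriv)
    hx h0
  rcases eq_or_ne x 0 with rfl | hx0
  · simpa using h 0 h0
  · simpa [hx0] using hconst

/-- The face form of the icosahedron. -/
def faceForm (x : ℝ) : ℝ := x ^ 4 + 228 * x ^ 3 + 494 * x ^ 2 - 228 * x + 1

/-- The vertex form of the icosahedron, without its factor `x`. -/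
def vertexForm (x : ℝ) : ℝ := x ^ 2 - 11 * x - 1

/-- The edge form of the icosahedron. -/
def edgeForm (x : ℝ) : ℝ := x ^ 6 - 522 * x ^ 5 - 10005 * x ^ 4 - 10005 * x ^ 2 + 522 * x + 1

/-- The icosahedral covering `ℙ¹ → ℙ¹`. -/
noncomputable def icosaMap (x : ℝ) : ℝ := 1728 * x * vertexForm x ^ 5 / faceForm x ^ 3

/-- The derivative of `faceForm`. -/
def faceForm' (x : ℝ) : ℝ := 4 * x ^ 3 + 684 * x ^ 2 + 988 * x - 228

/-- The derivative of `vertexForm`. -/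
def vertexForm' (x : ℝ) : ℝ := 2 * x - 11

/-- The derivative of `edgeForm`. -/
def edgeForm' (x : ℝ) : ℝ := 6 * x ^ 5 - 2610 * x ^ 4 - 40020 * x ^ 3 - 20010 * x + 522

theorem hasDerivAt_faceForm (x : ℝ) : HasDerivAt faceForm (faceForm' x) x := by
  refine (((((hasDerivAt_pow 4 x).add ((hasDerivAt_pow 3 x).const_mul 228)).add
    ((hasDerivAt_pow 2 x).const_mul 494)).sub ((hasDerivAt_id x).const_mul 228)).add_const
    1).congr_deriv ?_
  simp only [faceForm']
  push_cast
  ring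

theorem hasDerivAt_vertexForm (x : ℝ) : HasDerivAt vertexForm (vertexForm' x) x := by
  refine (((hasDerivAt_pow 2 x).sub ((hasDerivAt_id x).const_mul 11)).sub_const 1).congr_deriv ?_
  simp only [vertexForm']
  push_cast
  ring

theorem hasDerivAt_edgeForm (x : ℝ) : HasDerivAt edgeForm (edgeForm' x) x := by
  refine ((((((hasDerivAt_pow 6 x).sub ((hasDerivAt_pow 5 x).const_mul 522)).sub
    ((hasDerivAt_pow 4 x).const_mul 10005)).sub ((hasDerivAt_pow 2 x).const_mul 10005)).add
    ((hasDerivAt_id x).const_mul 522)).add_const 1).congr_deriv ?_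
  simp only [edgeForm']
  push_cast
  ring

/-- The derivative of `icosaMap`. -/
noncomputable def icosaMap' (x : ℝ) : ℝ := -1728 * edgeForm x * vertexForm x ^ 4 / faceForm x ^ 4

/-- The second derivative of `icosaMap`. -/
noncomputable def icosaMap'' (x : ℝ) : ℝ :=
  -1728 * vertexForm x ^ 3 * (edgeForm' x * vertexForm x * faceForm x +
    4 * edgeForm x * vertexForm' x * faceForm x - 4 * edgeForm x * vertexForm x * faceForm' x) /
    faceForm x ^ 5

theorem hasDerivAt_icosaMap {x : ℝ} (hx : faceForm x ≠ 0) :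
    HasDerivAt icosaMap (icosaMap' x) x := by
  refine ((((hasDerivAt_id x).const_mul 1728).mul ((hasDerivAt_vertexForm x).pow 5)).div
    ((hasDerivAt_faceForm x).pow 3) (pow_ne_zero 3 hx)).congr_deriv ?_
  simp only [icosaMap', Pi.mul_apply, Pi.pow_apply, id]
  field_simp
  simp only [faceForm, vertexForm, edgeForm, faceForm', vertexForm']
  push_cast
  ring

theorem hasDerivAt_icosaMap' {x : ℝ} (hx : faceForm x ≠ 0) :
    HasDerivAt icosaMap' (icosaMap'' x) x := by
  refine ((((hasDerivAt_edgeForm x).const_mul (-1728)).mul ((hasDerivAt_vertexForm x).pow 4)).div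
    ((hasDerivAt_faceForm x).pow 4) (pow_ne_zero 4 hx)).congr_deriv ?_
  simp only [icosaMap'', Pi.mul_apply, Pi.pow_apply]
  field_simp
  push_cast
  ring

/-- The logarithmic derivative of `faceForm ^ (11/20) / vertexForm`. -/
noncomputable def logDerivForm (x : ℝ) : ℝ :=
  11 / 20 * (faceForm' x / faceForm x) - vertexForm' x / vertexForm x

/-- The derivative of `logDerivForm`. -/
noncomputable def logDerivForm' (x : ℝ) : ℝ :=
  11 / 20 * (((12 * x ^ 2 + 1368 * x + 988) * faceForm x - faceForm' x ^ 2) / faceForm x ^ 2) -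
    (2 * vertexForm x - vertexForm' x ^ 2) / vertexForm x ^ 2

theorem hasDerivAt_logDerivForm {x : ℝ} (hx : faceForm x ≠ 0) (hx' : vertexForm x ≠ 0) :
    HasDerivAt logDerivForm (logDerivForm' x) x := by
  have h1 : HasDerivAt faceForm' (12 * x ^ 2 + 1368 * x + 988) x := by
    refine (((((hasDerivAt_pow 3 x).const_mul 4).add ((hasDerivAt_pow 2 x).const_mul 684)).add
      ((hasDerivAt_id x).const_mul 988)).sub_const 228).congr_deriv ?_
    push_cast
    ring
  have h2 : HasDerivAt vertexForm' 2 x :=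
    (((hasDerivAt_id x).const_mul 2).sub_const 11).congr_deriv (by ring)
  refine (((h1.div (hasDerivAt_faceForm x) hx).const_mul (11 / 20)).sub
    (h2.div (hasDerivAt_vertexForm x) hx')).congr_deriv ?_
  simp only [logDerivForm']
  ring

theorem one_sub_icosaMap {x : ℝ} (hx : faceForm x ≠ 0) :
    1 - icosaMap x = edgeForm x ^ 2 / faceForm x ^ 3 := by
  simp only [icosaMap]
  field_simp
  simp only [faceForm, vertexForm, edgeForm]
  ring

/-- `-faceForm ^ (-11/20) * vertexForm`. -/
noncomputable def gaugeFactor (x : ℝ) : ℝ := -vertexForm x * faceForm x ^ (-(11 / 20) : ℝ)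

theorem hasDerivAt_gaugeFactor {x : ℝ} (hx : 0 < faceForm x) (hx' : vertexForm x ≠ 0) :
    HasDerivAt gaugeFactor (-(logDerivForm x * gaugeFactor x)) x := by
  refine ((hasDerivAt_vertexForm x).neg.mul
    ((hasDerivAt_faceForm x).rpow_const (p := -(11 / 20)) (Or.inl hx.ne'))).congr_deriv ?_
  rw [Real.rpow_sub_one hx.ne']
  simp only [logDerivForm, gaugeFactor, Pi.neg_apply]
  field_simp
  ring

theorem mul_icosaMap'_sq {x : ℝ} (hx : faceForm x ≠ 0) (hx' : vertexForm x ≠ 0) :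
    faceForm x ^ 2 / (1728 * vertexForm x ^ 3) * x * icosaMap' x ^ 2 =
      icosaMap x * (1 - icosaMap x) := by
  rw [one_sub_icosaMap hx]
  simp only [icosaMap, icosaMap']
  field_simp

theorem pullback_coeff_zero {x : ℝ} (hx : faceForm x ≠ 0) (hx' : vertexForm x ≠ 0) :
    faceForm x ^ 2 / (1728 * vertexForm x ^ 3) *
      (x * (logDerivForm x ^ 2 - logDerivForm' x) - 6 / 5 * logDerivForm x) +
        11 / 60 * (31 / 60) = 0 := by
  simp only [logDerivForm, logDerivForm']
  field_simp
  simp only [faceForm, vertexForm, faceForm', vertexForm']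
  ring

theorem pullback_coeff_one {x : ℝ} (hx : faceForm x ≠ 0) (hx' : vertexForm x ≠ 0) :
    faceForm x ^ 2 / (1728 * vertexForm x ^ 3) *
      (x * (icosaMap'' x - 2 * icosaMap' x * logDerivForm x) + 6 / 5 * icosaMap' x) -
        (6 / 5 - (11 / 60 + 31 / 60 + 1) * icosaMap x) = 0 := by
  simp only [logDerivForm, icosaMap, icosaMap', icosaMap'']
  field_simp
  simp only [faceForm, vertexForm, edgeForm, faceForm', vertexForm', edgeForm']
  ring

theorem hypgeo_zero (a b c : ℝ) : hypgeo a b c 0 = 1 := by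
  rw [hypgeo, tsum_eq_single 0 fun n hn => by simp [hn]]
  simp

theorem stmt14 : ∃ ε > 0, ∀ x : ℝ, |x| < ε →
    hypgeo (11/60) (31/60) (6/5) (1728 * x * (x^2 - 11*x - 1)^5 / (x^4 + 228*x^3 + 494*x^2 - 228*x + 1)^3) =
      (1 - 228*x + 494*x^2 + 228*x^3 + x^4) ^ ((11 : ℝ)/20) / (1 + 11*x - x^2) := by
  have hP0 : faceForm 0 = 1 := by norm_num [faceForm]
  have hQ0 : vertexForm 0 = -1 := by norm_num [vertexForm]
  have hφ0 : icosaMap 0 = 0 := by norm_num [icosaMap]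
  have hP : ∀ᶠ x in nhds 0, 0 < faceForm x :=
    (hasDerivAt_faceForm 0).continuousAt.eventually_const_lt (by norm_num [hP0])
  have hQ : ∀ᶠ x in nhds 0, vertexForm x ≠ 0 :=
    (hasDerivAt_vertexForm 0).continuousAt.eventually_ne (by norm_num [hQ0])
  have hφ : ∀ᶠ x in nhds 0, |icosaMap x| < 1 :=
    (hasDerivAt_icosaMap (by norm_num [hP0])).continuousAt.abs.eventually_lt_const
      (by norm_num [hφ0])
  obtain ⟨ε, hε, hball⟩ := Metric.eventually_nhds_iff_ball.1 (hP.and (hQ.and hφ))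
  refine ⟨ε, hε, fun x hx => ?_⟩
  replace hx : x ∈ Metric.ball (0 : ℝ) ε := by simpa using hx
  have hg : PolyGrowth (hypgeoCoeff (11 / 60) (31 / 60) (6 / 5)) :=
    polyGrowth_hypgeoCoeff (by norm_num) (by norm_num) (by norm_num) (by norm_num) (by norm_num)
  set F := hypgeo (11 / 60) (31 / 60) (6 / 5) with hF
  set F1 : ℝ → ℝ := fun z =>
    ∑' n, derivCoeff (hypgeoCoeff (11 / 60) (31 / 60) (6 / 5)) n * z ^ n
  set F2 : ℝ → ℝ := fun z =>
    ∑' n, derivCoeff (derivCoeff (hypgeoCoeff (11 / 60) (31 / 60) (6 / 5))) n * z ^ n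
  have hFd : ∀ z, |z| < 1 → HasDerivAt F (F1 z) z := fun z hz => hg.hasDerivAt_tsum hz
  have hF1d : ∀ z, |z| < 1 → HasDerivAt F1 (F2 z) z := fun z hz => hg.deriv.hasDerivAt_tsum hz
  have hy : ∀ x ∈ Metric.ball (0 : ℝ) ε, HasDerivAt (fun x => F (icosaMap x) * gaugeFactor x)
      (gaugeFactor x * (F1 (icosaMap x) * icosaMap' x - F (icosaMap x) * logDerivForm x)) x := by
    intro x hx
    obtain ⟨h1, h2, h3⟩ := hball x hx
    refine (((hFd _ h3).comp x (hasDerivAt_icosaMap h1.ne')).mul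
      (hasDerivAt_gaugeFactor h1 h2)).congr_deriv ?_
    simp only [Function.comp]
    ring
  have hzero := eq_zero_of_mul_deriv_eq (fun x hx => by
      obtain ⟨h1, h2, h3⟩ := hball x hx
      exact (hasDerivAt_gaugeFactor h1 h2).mul
        ((((hF1d _ h3).comp x (hasDerivAt_icosaMap h1.ne')).mul (hasDerivAt_icosaMap' h1.ne')).sub
        (((hFd _ h3).comp x (hasDerivAt_icosaMap h1.ne')).mul (hasDerivAt_logDerivForm h1.ne' h2))))
    (fun x hx => by
      obtain ⟨h1, h2, h3⟩ := hball x hx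
      have hode := hypgeo_ode (by norm_num) hg h3
      have hk : faceForm x ^ 2 / (1728 * vertexForm x ^ 3) ≠ 0 := by
        have := h1.ne'
        positivity
      apply mul_left_cancel₀ hk
      simp only [Function.comp, Pi.mul_apply, Pi.sub_apply]
      linear_combination gaugeFactor x * (hode + F2 (icosaMap x) * mul_icosaMap'_sq h1.ne' h2 +
        F (icosaMap x) * pullback_coeff_zero h1.ne' h2 +
        F1 (icosaMap x) * pullback_coeff_one h1.ne' h2))
  have hconst := Metric.isOpen_ball.is_const_of_deriv_eq_zero (convex_ball (0 : ℝ) ε).isPreconnected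
    (fun y hy' => (hy y hy').differentiableAt.differentiableWithinAt)
    (fun y hy' => (hy y hy').deriv.trans (hzero y hy')) hx (Metric.mem_ball_self hε)
  simp only [hφ0, gaugeFactor, hP0, hQ0, hF, hypgeo_zero] at hconst
  obtain ⟨h1, h2, -⟩ := hball x hx
  have e1 : 1 - 228*x + 494*x^2 + 228*x^3 + x^4 = faceForm x := by rw [faceForm]; ring
  have e2 : 1 + 11*x - x^2 = -vertexForm x := by rw [vertexForm]; ring
  have e3 : 1728 * x * (x^2 - 11*x - 1)^5 / (x^4 + 228*x^3 + 494*x^2 - 228*x + 1)^3 =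
    icosaMap x := rfl
  rw [e1, e2, e3, eq_div_iff (neg_ne_zero.2 h2)]
  rw [Real.rpow_neg h1.le] at hconst
  have hr : 0 < faceForm x ^ ((11 : ℝ) / 20) := Real.rpow_pos_of_pos h1 _
  field_simp at hconst
  simpa using hconst
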